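/- Let T be a tree chosen uniformly at random from the set of labelled trees on n vertices. For every c > 0, if n is sufficiently large, then the probability that some vertex of T has degree greater than cn/log n is at most e^{-cn/2}. -/

import Mathlib

namespace RTD
open Finset

def Rooted {n : ℕ} (v : Fin n) (p : Fin n → Fin n) : Prop :=
  p v = v ∧ ∀ x, ∃ i : ℕ, p^[i] x = v

def ch {n : ℕ} (v : Fin n) (p : Fin n → Fin n) : Finset (Fin n) :=
  univ.filter (fun u => u ≠ v ∧ p u = v)

open Classical in
noncomputable def A {n : ℕ} (v : Fin n) (k : ℕ) : Finset (Fin n → Fin n) :=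
  univ.filter (fun p => Rooted v p ∧ k ≤ (ch v p).card)

lemma iter_fix {n : ℕ} {v : Fin n} {p : Fin n → Fin n} (h : p v = v) (i : ℕ) : p^[i] v = v :=
  Function.iterate_fixed h i

lemma anc_unique_aux {n : ℕ} {v : Fin n} {p : Fin n → Fin n} (h : p v = v) {w u u' : Fin n}
    (hu : p u = v) (hu' : u' ≠ v) {i j : ℕ} (hi : p^[i] w = u)
    (hj : p^[j] w = u') (hij : i < j) : False := by
  obtain ⟨d, rfl⟩ := Nat.exists_eq_add_of_lt hij
  apply hu'
  rw [← hj, show i + d + 1 = d + 1 + i by ring, Function.iterate_add_apply, hi,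
    Function.iterate_add_apply, Function.iterate_one, hu, iter_fix h]

lemma anc_unique {n : ℕ} {v : Fin n} {p : Fin n → Fin n} (h : p v = v) {w u u' : Fin n}
    (hu : u ∈ ch v p) (hu' : u' ∈ ch v p) {i j : ℕ} (hi : p^[i] w = u)
    (hj : p^[j] w = u') : u = u' := by
  simp only [ch, mem_filter, mem_univ, true_and] at hu hu'
  rcases lt_trichotomy i j with hij | hij | hij
  · exact (anc_unique_aux h hu.2 hu'.1 hi hj hij).elim
  · rw [← hi, ← hj, hij]
  · exact (anc_unique_aux h hu'.2 hu.1 hj hi hij).elim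

lemma rooted_update {n : ℕ} {v : Fin n} {p : Fin n → Fin n} (h : Rooted v p) {u w : Fin n}
    (huv : u ≠ v) (hw : ∀ i : ℕ, p^[i] w ≠ u) : Rooted v (Function.update p u w) := by
  set q := Function.update p u w with hq
  have hqv : q v = v := by rw [hq, Function.update_of_ne huv.symm, h.1]
  have key : ∀ i : ℕ, ∀ x, (∀ j, p^[j] x ≠ u) → q^[i] x = p^[i] x := by
    intro i
    induction i with
    | zero => intro x _; rfl
    | succ i ih =>
      intro x hx
      have h0 : x ≠ u := hx 0
      have : q x = p x := by rw [hq, Function.update_of_ne h0]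
      rw [Function.iterate_succ_apply, Function.iterate_succ_apply, this]
      exact ih _ (fun j => hx (j+1))
  have hwv : ∃ i : ℕ, q^[i] w = v := by
    obtain ⟨i, hi⟩ := h.2 w
    exact ⟨i, by rw [key i w hw, hi]⟩
  have huq : ∃ i : ℕ, q^[i] u = v := by
    obtain ⟨i, hi⟩ := hwv
    refine ⟨i+1, ?_⟩
    rw [Function.iterate_succ_apply, hq, Function.update_self, ← hq, hi]
  refine ⟨hqv, ?_⟩
  have main : ∀ i : ℕ, ∀ x, p^[i] x = v → ∃ j : ℕ, q^[j] x = v := by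
    intro i
    induction i with
    | zero => intro x hx; exact ⟨0, hx⟩
    | succ i ih =>
      intro x hx
      by_cases hxu : x = u
      · rw [hxu]; exact huq
      · obtain ⟨j, hj⟩ := ih (p x) hx
        refine ⟨j+1, ?_⟩
        have : q x = p x := by rw [hq, Function.update_of_ne hxu]
        rw [Function.iterate_succ_apply, this, hj]
  intro x
  obtain ⟨i, hi⟩ := h.2 x
  exact main i x hi

open Classical in
lemma step {n : ℕ} (hn : 2 ≤ n) (v : Fin n) (k : ℕ) : (A v (k+1)).card * k ≤ (A v k).card := by
  let S : Finset (Σ _ : (Fin n → Fin n) × Fin n, Fin n) :=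
    ((A v (k+1)) ×ˢ (univ.erase v)).sigma
      (fun pw => (ch v pw.1).filter (fun u => ∀ i : ℕ, pw.1^[i] pw.2 ≠ u))
  have hS1 : (A v (k+1)).card * (n-1) * k ≤ S.card := by
    rw [card_sigma]
    have : (A v (k+1)).card * (n-1) = ((A v (k+1)) ×ˢ (univ.erase v)).card := by
      rw [card_product, card_erase_of_mem (mem_univ _), card_univ, Fintype.card_fin]
    rw [this, ← smul_eq_mul]
    apply card_nsmul_le_sum
    rintro ⟨p, w⟩ hpw
    simp only [mem_product, A, mem_filter, mem_univ, true_and] at hpw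
    obtain ⟨⟨hp, hk⟩, _⟩ := hpw
    have h1 := card_filter_add_card_filter_not (s := ch v p) (fun u => ∀ i : ℕ, p^[i] w ≠ u)
    have h2 : ((ch v p).filter (fun u => ¬ ∀ i : ℕ, p^[i] w ≠ u)).card ≤ 1 := by
      rw [card_le_one]
      intro a ha b hb
      simp only [mem_filter, not_forall, not_not] at ha hb
      obtain ⟨ha, i, hi⟩ := ha
      obtain ⟨hb, j, hj⟩ := hb
      exact anc_unique hp.1 ha hb hi hj
    simp only
    omega
  have hS2 : S.card ≤ ((A v k) ×ˢ (univ.erase v)).card := by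
    apply card_le_card_of_injOn (fun s => (Function.update s.1.1 s.2 s.1.2, s.2))
    · rintro ⟨⟨p, w⟩, u⟩ hs
      simp only [S, coe_sigma, Set.mem_sigma_iff, mem_coe, mem_product, A, mem_filter, mem_univ,
        true_and, mem_erase, and_true] at hs
      obtain ⟨⟨⟨hp, hk⟩, hwv⟩, hu, huw⟩ := hs
      have hu' := hu
      simp only [ch, mem_filter, mem_univ, true_and] at hu'
      simp only [mem_coe, mem_product, A, mem_filter, mem_univ, true_and, mem_erase, and_true]
      refine ⟨⟨rooted_update hp hu'.1 huw, ?_⟩, hu'.1⟩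
      have : (ch v p).erase u ⊆ ch v (Function.update p u w) := by
        intro x hx
        simp only [ch, mem_erase, mem_filter, mem_univ, true_and] at hx ⊢
        refine ⟨hx.2.1, ?_⟩
        rw [Function.update_of_ne hx.1, hx.2.2]
      have h2 := card_le_card this
      rw [card_erase_of_mem hu] at h2
      omega
    · rintro ⟨⟨p, w⟩, u⟩ hs ⟨⟨p', w'⟩, u'⟩ hs' heq
      simp only [S, coe_sigma, Set.mem_sigma_iff, mem_coe, mem_filter, ch, mem_univ,
        true_and] at hs hs'
      simp only [Prod.mk.injEq] at heq
      obtain ⟨h1, rfl⟩ := heq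
      have hw : w = w' := by
        have := congrFun h1 u
        simpa using this
      have hp : p = p' := by
        funext x
        by_cases hx : x = u
        · rw [hx, hs.2.1.2, hs'.2.1.2]
        · have := congrFun h1 x
          simpa [hx] using this
      subst hw; subst hp; rfl
  rw [card_product, card_erase_of_mem (mem_univ _), card_univ, Fintype.card_fin] at hS2
  have h3 : (A v (k+1)).card * k * (n-1) ≤ (A v k).card * (n-1) := by
    calc _ = (A v (k+1)).card * (n-1) * k := by ring
      _ ≤ _ := hS1.trans hS2
  exact Nat.le_of_mul_le_mul_right h3 (by omega)

lemma A_fact {n : ℕ} (hn : 2 ≤ n) (v : Fin n) (k : ℕ) :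
    (A v (k+1)).card * k.factorial ≤ (A v 0).card := by
  induction k with
  | zero =>
    simp only [Nat.factorial_zero, mul_one]
    apply card_le_card
    intro p hp
    simp only [A, mem_filter] at hp ⊢
    exact ⟨hp.1, hp.2.1, Nat.zero_le _⟩
  | succ k ih =>
    rw [Nat.factorial_succ, ← mul_assoc]
    exact (Nat.mul_le_mul_right _ (step hn v (k+1))).trans ih

/-- the graph of a parent function -/
def G {n : ℕ} (p : Fin n → Fin n) : SimpleGraph (Fin n) :=
  SimpleGraph.fromRel (fun x y => p x = y)

lemma G_adj {n : ℕ} (p : Fin n → Fin n) (x y : Fin n) :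
    (G p).Adj x y ↔ x ≠ y ∧ (p x = y ∨ p y = x) := Iff.rfl

lemma G_conn {n : ℕ} {v : Fin n} {p : Fin n → Fin n} (h : Rooted v p) : (G p).Connected := by
  have key : ∀ i : ℕ, ∀ x, p^[i] x = v → (G p).Reachable x v := by
    intro i
    induction i with
    | zero => intro x hx; exact hx ▸ SimpleGraph.Reachable.refl _
    | succ i ih =>
      intro x hx
      have h1 := ih (p x) hx
      by_cases hxp : x = p x
      · rw [hxp]; exact h1
      · exact (SimpleGraph.Adj.reachable ((G_adj p x (p x)).2 ⟨hxp, Or.inl rfl⟩)).trans h1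
  have k2 : ∀ x, (G p).Reachable x v := fun x => by
    obtain ⟨i, hi⟩ := h.2 x
    exact key i x hi
  haveI : Nonempty (Fin n) := ⟨v⟩
  exact SimpleGraph.Connected.mk (fun x y => (k2 x).trans (k2 y).symm)

lemma G_tree {n : ℕ} {v : Fin n} {p : Fin n → Fin n} (h : Rooted v p) : (G p).IsTree := by
  classical
  have hc := G_conn h
  rw [SimpleGraph.isTree_iff_connected_and_card]
  refine ⟨hc, le_antisymm ?_ hc.card_vert_le_card_edgeSet_add_one⟩
  have h1 : (G p).edgeSet ⊆ ((univ.erase v).image (fun x => s(x, p x)) : Finset (Sym2 (Fin n))) := by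
    intro e he
    induction e using Sym2.ind with
    | _ x y =>
      rw [SimpleGraph.mem_edgeSet, G_adj] at he
      obtain ⟨hne, hxy⟩ := he
      simp only [coe_image, Set.mem_image, mem_coe, mem_erase, mem_univ, and_true]
      rcases hxy with hxy | hxy
      · refine ⟨x, ?_, by rw [hxy]⟩
        rintro rfl
        exact hne (h.1.symm.trans hxy)
      · refine ⟨y, ?_, by rw [hxy, Sym2.eq_swap]⟩
        rintro rfl
        exact hne (hxy.symm.trans h.1)
  have h2 := Set.ncard_le_ncard h1 (Finset.finite_toSet _)
  rw [Set.ncard_coe_finset] at h2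
  have h3 := h2.trans card_image_le
  rw [card_erase_of_mem (mem_univ _), card_univ, Fintype.card_fin] at h3
  have h4 : 0 < n := v.pos
  rw [Nat.card_coe_set_eq, Nat.card_fin]
  omega

lemma G_nbr {n : ℕ} {v : Fin n} {p : Fin n → Fin n} (h : Rooted v p) :
    ((G p).neighborSet v).ncard = (ch v p).card := by
  rw [← Set.ncard_coe_finset]
  congr 1
  ext x
  simp only [SimpleGraph.mem_neighborSet, G_adj, ch, coe_filter, mem_univ, true_and,
    Set.mem_setOf_eq, h.1]
  grind

lemma G_inj {n : ℕ} {v : Fin n} {p q : Fin n → Fin n} (hp : Rooted v p) (hq : Rooted v q)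
    (h : G p = G q) : p = q := by
  have key : ∀ i : ℕ, ∀ x, p^[i] x = v → q x = p x := by
    intro i
    induction i with
    | zero => intro x hx; change x = v at hx; rw [hx, hp.1, hq.1]
    | succ i ih =>
      intro x hx
      have h1 := ih (p x) hx
      by_cases hxv : x = v
      · rw [hxv, hp.1, hq.1]
      have hinv : ∀ j : ℕ, p (p x) = x → (p^[j] x = x ∨ p^[j] x = p x) := by
        intro j hx2
        induction j with
        | zero => exact Or.inl rfl
        | succ j ihj =>
          rw [Function.iterate_succ_apply']
          rcases ihj with h | h <;> rw [h]
          · exact Or.inr rfl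
          · exact Or.inl hx2
      have hno : p (p x) ≠ x := by
        intro hx2
        rcases hinv (i+1) hx2 with h | h
        · exact hxv (h.symm.trans hx)
        · rw [hx] at h
          rw [← h, hp.1] at hx2
          exact hxv hx2.symm
      have hne : x ≠ p x := by
        intro h; apply hno; rw [← h, ← h]
      have hadj : (G q).Adj x (p x) := by
        rw [← h, G_adj]; exact ⟨hne, Or.inl rfl⟩
      rw [G_adj] at hadj
      rcases hadj.2 with h2 | h2
      · exact h2
      · exact (hno (h1.symm.trans h2)).elim
  funext x
  obtain ⟨i, hi⟩ := hp.2 x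
  exact (key i x hi).symm

lemma G_surj {n : ℕ} (v : Fin n) {T : SimpleGraph (Fin n)} (hT : T.IsTree) :
    ∃ p, Rooted v p ∧ G p = T := by
  have hex : ∀ x, ∃ y, (x = v → y = v) ∧ (x ≠ v → T.Adj x y ∧ T.dist y v < T.dist x v) := by
    intro x
    by_cases hx : x = v
    · exact ⟨v, fun _ => rfl, fun h => (h hx).elim⟩
    · obtain ⟨w, hw⟩ := (hT.1 x v).exists_walk_length_eq_dist
      cases w with
      | nil => exact (hx rfl).elim
      | cons hadj w' =>
        rename_i y
        refine ⟨y, fun h => (hx h).elim, fun _ => ⟨hadj, ?_⟩⟩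
        rw [← hw, SimpleGraph.Walk.length_cons]
        have := SimpleGraph.dist_le w'
        omega
  choose p h1 h2 using hex
  have hr : Rooted v p := by
    refine ⟨h1 v rfl, ?_⟩
    have : ∀ d : ℕ, ∀ x, T.dist x v ≤ d → ∃ i : ℕ, p^[i] x = v := by
      intro d
      induction d with
      | zero =>
        intro x hx
        by_cases hxv : x = v
        · exact ⟨0, hxv⟩
        · have := (h2 x hxv).2; omega
      | succ d ih =>
        intro x hx
        by_cases hxv : x = v
        · exact ⟨0, hxv⟩
        · have := (h2 x hxv).2
          obtain ⟨i, hi⟩ := ih (p x) (by omega)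
          exact ⟨i+1, hi⟩
    exact fun x => this _ x le_rfl
  refine ⟨p, hr, ?_⟩
  have hle : G p ≤ T := by
    intro x y hxy
    rw [G_adj] at hxy
    obtain ⟨hne, h | h⟩ := hxy
    · have hx : x ≠ v := by
        rintro rfl
        exact hne ((h1 x rfl).symm.trans h)
      rw [← h]; exact (h2 x hx).1
    · have hx : y ≠ v := by
        rintro rfl
        exact hne (h.symm.trans (h1 y rfl))
      rw [← h]; exact (h2 y hx).1.symm
  have e1 := (SimpleGraph.isTree_iff_connected_and_card.1 (G_tree hr)).2
  have e2 := (SimpleGraph.isTree_iff_connected_and_card.1 hT).2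
  have hsub : (G p).edgeSet ⊆ T.edgeSet := SimpleGraph.edgeSet_mono hle
  rw [Nat.card_coe_set_eq] at e1 e2
  have := Set.eq_of_subset_of_ncard_le hsub (by omega) (Set.toFinite _)
  exact SimpleGraph.edgeSet_inj.1 this

lemma card_A {n : ℕ} (v : Fin n) (k : ℕ) :
    {T : SimpleGraph (Fin n) | T.IsTree ∧ k ≤ (T.neighborSet v).ncard}.ncard = (A v k).card := by
  classical
  rw [← Set.ncard_coe_finset]
  symm
  apply Set.ncard_congr (fun p _ => G p)
  · intro p hp
    simp only [A, coe_filter, mem_univ, true_and, Set.mem_setOf_eq] at hp ⊢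
    exact ⟨G_tree hp.1, by rw [G_nbr hp.1]; exact hp.2⟩
  · intro p q hp hq h
    simp only [A, coe_filter, mem_univ, true_and, Set.mem_setOf_eq] at hp hq
    exact G_inj hp.1 hq.1 h
  · rintro T ⟨hT, hk⟩
    obtain ⟨p, hp, rfl⟩ := G_surj v hT
    refine ⟨p, ?_, rfl⟩
    simp only [A, coe_filter, mem_univ, true_and, Set.mem_setOf_eq]
    exact ⟨hp, by rw [← G_nbr hp]; exact hk⟩

lemma count {n : ℕ} (hn : 2 ≤ n) (m : ℕ) :
    {T : SimpleGraph (Fin n) | T.IsTree ∧ ∃ v, m + 1 ≤ (T.neighborSet v).ncard}.ncard * m.factorial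
      ≤ n * {T : SimpleGraph (Fin n) | T.IsTree}.ncard := by
  have h1 : {T : SimpleGraph (Fin n) | T.IsTree ∧ ∃ v, m + 1 ≤ (T.neighborSet v).ncard} =
      ⋃ v ∈ (univ : Finset (Fin n)), {T : SimpleGraph (Fin n) | T.IsTree ∧ m + 1 ≤ (T.neighborSet v).ncard} := by
    ext T; simp
  rw [h1]
  refine (Nat.mul_le_mul_right _ (Finset.set_ncard_biUnion_le _ _)).trans ?_
  rw [sum_mul]
  have : ∀ v ∈ (univ : Finset (Fin n)),
      {T : SimpleGraph (Fin n) | T.IsTree ∧ m + 1 ≤ (T.neighborSet v).ncard}.ncard * m.factorial ≤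
      {T : SimpleGraph (Fin n) | T.IsTree}.ncard := by
    intro v _
    rw [card_A]
    refine (A_fact hn v m).trans ?_
    rw [← card_A]
    exact Set.ncard_le_ncard (fun T hT => hT.1) (Set.toFinite _)
  refine (sum_le_card_nsmul _ _ _ this).trans ?_
  simp

open Filter in
lemma analytic (c : ℝ) (hc : 0 < c) : ∀ᶠ n : ℕ in atTop,
    (n : ℝ) * Real.exp (c * n / 2) ≤ ((⌊c * n / Real.log n⌋₊).factorial : ℝ) := by
  have hlog : Tendsto (fun n : ℕ => Real.log (n:ℝ)) atTop atTop :=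
    Real.tendsto_log_atTop.comp tendsto_natCast_atTop_atTop
  have e1 : ∀ᶠ n : ℕ in atTop, Real.log (n:ℝ) ≤ min 1 (c/2) * (n:ℝ)^(1/4:ℝ) := by
    have := ((isLittleO_log_rpow_atTop (r := 1/4) (by norm_num)).comp_tendsto
      tendsto_natCast_atTop_atTop).bound (c := min 1 (c/2)) (by positivity)
    filter_upwards [this] with n hn
    simp only [Function.comp, Real.norm_eq_abs] at hn
    rw [abs_of_nonneg (a := (n:ℝ)^(1/4:ℝ)) (by positivity)] at hn
    exact (le_abs_self _).trans hn
  have e2 : ∀ᶠ n : ℕ in atTop, Real.log (n:ℝ) ≤ (c/14) * (n:ℝ) := by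
    have := (Real.isLittleO_log_id_atTop.comp_tendsto
      tendsto_natCast_atTop_atTop).bound (c := c/14) (by positivity)
    filter_upwards [this] with n hn
    simp only [Function.comp, Real.norm_eq_abs, id] at hn
    rw [abs_of_nonneg (a := (n:ℝ)) (by positivity)] at hn
    exact (le_abs_self _).trans hn
  filter_upwards [e1, e2, hlog.eventually_ge_atTop 8, eventually_ge_atTop 2] with n h1 h2 h3 h4
  have hn0 : (0:ℝ) < n := by positivity
  set l := Real.log (n:ℝ) with hl
  set D := c * n / l with hD
  set m := ⌊D⌋₊ with hm
  have hl0 : 0 < l := by linarith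
  have hDl : D * l = c * n := by rw [hD]; field_simp
  have hmD : D - 1 ≤ m := by
    have := Nat.lt_floor_add_one D
    linarith
  have hx : (0:ℝ) < (n:ℝ)^(1/4:ℝ) := by positivity
  set x := (n:ℝ)^(1/4:ℝ) with hxd
  have hx4 : x^4 = n := by
    rw [hxd, ← Real.rpow_natCast, ← Real.rpow_mul hn0.le]; norm_num
  have hlx : l ≤ x := h1.trans (by nlinarith [min_le_left 1 (c/2)])
  have hlc : l ≤ c/2 * x := h1.trans (by nlinarith [min_le_right 1 (c/2)])
  have hD2 : 2 * x^3 ≤ D := by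
    rw [hD, le_div_iff₀ hl0, ← hx4]
    have : 0 < x^3 := by positivity
    nlinarith
  have hx1 : 1 ≤ x := by linarith
  have hx31 : 1 ≤ x^3 := one_le_pow₀ hx1
  have hmx : x^3 ≤ m := by linarith
  have hm0 : (0:ℝ) < m := by linarith
  have hlm : 3/4 * l ≤ Real.log m := by
    have := Real.log_le_log (by positivity) hmx
    rw [Real.log_pow, hxd, Real.log_rpow hn0] at this
    push_cast at this
    linarith
  have hfac : ((m:ℝ)^m) / (m.factorial) ≤ Real.exp m := Real.pow_div_factorial_le_exp _ hm0.le _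
  have hf0 : (0:ℝ) < m.factorial := by positivity
  rw [div_le_iff₀ hf0] at hfac
  have hmm : (m:ℝ)^m = Real.exp (m * Real.log m) := by
    rw [mul_comm, Real.exp_mul, Real.exp_log hm0, Real.rpow_natCast]
  have hf : Real.exp (m * Real.log m - m) ≤ m.factorial := by
    rw [Real.exp_sub, div_le_iff₀ (Real.exp_pos _), ← hmm, mul_comm]; exact hfac
  refine le_trans ?_ hf
  have hnl : (n:ℝ) = Real.exp l := (Real.exp_log hn0).symm
  have : (n : ℝ) * Real.exp (c * n / 2) = Real.exp (l + c * n / 2) := by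
    rw [Real.exp_add, ← hnl]
  rw [this, Real.exp_le_exp]
  have b1 : (D - 1) * (3/4 * l - 1) ≤ m * (Real.log m - 1) := by
    apply mul_le_mul hmD (by linarith) (by linarith) hm0.le
  have b2 : D * 8 ≤ c * n := by rw [← hDl]; apply mul_le_mul_of_nonneg_left h3; linarith
  nlinarith

end RTD

theorem random_tree_max_degree (c : ℝ) (hc : 0 < c) :
    ∃ n₀ : ℕ, ∀ n : ℕ, n₀ ≤ n →
      (Nat.card {T : SimpleGraph (Fin n) //
          T.IsTree ∧ ∃ v : Fin n, c * n / Real.log n < ((T.neighborSet v).ncard : ℝ)} : ℝ)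
        ≤ Real.exp (-(c * n) / 2) *
            (Nat.card {T : SimpleGraph (Fin n) // T.IsTree} : ℝ) := by
  obtain ⟨n₀, h⟩ := Filter.eventually_atTop.1
    ((RTD.analytic c hc).and (Filter.eventually_ge_atTop 2))
  refine ⟨n₀, fun n hn => ?_⟩
  obtain ⟨h1, h2⟩ := h n hn
  set m := ⌊c * n / Real.log n⌋₊ with hm
  have hcnt := RTD.count h2 m
  have hD : 0 ≤ c * n / Real.log n := by
    have := Real.log_natCast_nonneg n
    positivity
  have hset : {T : SimpleGraph (Fin n) |
      T.IsTree ∧ ∃ v : Fin n, c * n / Real.log n < ((T.neighborSet v).ncard : ℝ)} =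
      {T : SimpleGraph (Fin n) | T.IsTree ∧ ∃ v, m + 1 ≤ (T.neighborSet v).ncard} := by
    ext T
    simp only [Set.mem_setOf_eq, Nat.succ_le_iff, hm, Nat.floor_lt hD]
  have hb : Nat.card {T : SimpleGraph (Fin n) //
      T.IsTree ∧ ∃ v : Fin n, c * n / Real.log n < ((T.neighborSet v).ncard : ℝ)} =
      {T : SimpleGraph (Fin n) | T.IsTree ∧ ∃ v, m + 1 ≤ (T.neighborSet v).ncard}.ncard := by
    rw [← hset]; exact Nat.card_coe_set_eq _
  have ht : Nat.card {T : SimpleGraph (Fin n) // T.IsTree} =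
      {T : SimpleGraph (Fin n) | T.IsTree}.ncard := Nat.card_coe_set_eq _
  rw [hb, ht]
  generalize {T : SimpleGraph (Fin n) | T.IsTree ∧ ∃ v, m + 1 ≤ (T.neighborSet v).ncard}.ncard = B
    at hcnt ⊢
  generalize {T : SimpleGraph (Fin n) | T.IsTree}.ncard = N at hcnt ⊢
  have hcnt' : (B:ℝ) * m.factorial ≤ n * N := by exact_mod_cast hcnt
  have hn0 : (0:ℝ) < n := by positivity
  have e : Real.exp (-(c * n) / 2) = (Real.exp (c * n / 2))⁻¹ := by
    rw [← Real.exp_neg]; congr 1; ring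
  rw [e, inv_mul_eq_div, le_div_iff₀ (Real.exp_pos _)]
  have h3 : (B:ℝ) * (n * Real.exp (c * n / 2)) ≤ n * N :=
    (mul_le_mul_of_nonneg_left h1 (Nat.cast_nonneg _)).trans hcnt'
  have h4 : (n:ℝ) * (B * Real.exp (c * n / 2)) ≤ n * N := by linarith
  exact le_of_mul_le_mul_left h4 hn0
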